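/- arXiv:1310.7844 — 2 statements merged into one kernel-verified Lean document; each statement's English description precedes it below -/
import Mathlib

section
/- Let V be a closed linear subspace of C(ℂ,ℂ) (the space of continuous functions from ℂ to ℂ with the topology of uniform convergence on compact sets) such that T_{a,b}(V) ⊆ V for all a,b ∈ ℂ. Then there exists a finite set of pairs {(n_k,m_k)}_{k=1}^r ⊆ (ℕ ∪ {+∞})² such that V is the closed linear span (in C(ℂ,ℂ)) of the set of monomial functions {z ↦ z^α·conj(z)^β : α,β ∈ ℕ and there exists k ∈ {1,…,r} with α ≤ n_k and β ≤ m_k}. -/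
open Filter Topology

theorem SW_mem_closure (S : Set C(ℂ, ℂ)) (g : C(ℂ, ℂ))
    (h : ∀ K : Set ℂ, IsCompact K → ∀ ε : ℝ, 0 < ε → ∃ f ∈ S, ∀ z ∈ K, dist (g z) (f z) < ε) :
    g ∈ closure S := by
  rw [mem_closure_iff_nhds_basis
    (nhds_basis_uniformity' (ContinuousMap.hasBasis_compactConvergenceUniformity (α := ℂ) (β := ℂ)))]
  rintro ⟨K, U⟩ ⟨hK, hU⟩
  obtain ⟨ε, hε, hεU⟩ := Metric.mem_uniformity_dist.1 hU
  obtain ⟨f, hf, hfK⟩ := h K hK ε hε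
  exact ⟨f, hf, fun z hz => hεU (hfK z hz)⟩

/-- lower sets of `ℕ` -/
theorem SW_lower_nat (A : Set ℕ) (hA : ∀ a ∈ A, ∀ b ≤ a, b ∈ A) (h0 : 0 ∈ A) :
    ∃ m : ℕ∞, ∀ b : ℕ, b ∈ A ↔ (b : ℕ∞) ≤ m := by
  by_cases h : ∃ n, n ∉ A
  · classical
    have hs := Nat.find_spec h
    have hm : ∀ k, k < Nat.find h → k ∈ A := fun k hk => not_not.1 (Nat.find_min h hk)
    generalize Nat.find h = N at hs hm
    have hN : N ≠ 0 := fun h => hs (h ▸ h0)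
    refine ⟨((N - 1 : ℕ) : ℕ∞), fun b => ?_⟩
    rw [Nat.cast_le]
    constructor
    · intro hb
      by_contra hlt
      exact hs (hA b hb N (by omega))
    · intro hb
      exact hm b (by omega)
  · push Not at h
    exact ⟨⊤, fun b => by simp [h b]⟩

theorem SW_dickson (M : ℕ → ℕ → Prop) (h1 : ∀ a b, M (a + 1) b → M a b)
    (h2 : ∀ a b, M a (b + 1) → M a b) :
    ∃ S : Finset (ℕ∞ × ℕ∞), ∀ a b : ℕ, M a b ↔ ∃ p ∈ S, (a : ℕ∞) ≤ p.1 ∧ (b : ℕ∞) ≤ p.2 := by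
  classical
  have h1' : ∀ a a' b, a' ≤ a → M a b → M a' b := by
    intro a a' b h
    induction h with
    | refl => exact id
    | step _ ih => exact fun h => ih (h1 _ _ h)
  have h2' : ∀ a b b', b' ≤ b → M a b → M a b' := by
    intro a b b' h
    induction h with
    | refl => exact id
    | step _ ih => exact fun h => ih (h2 _ _ h)
  have key : ∀ a, ∃ o : Finset ℕ∞, ∀ b : ℕ, M a b ↔ ∃ m ∈ o, (b : ℕ∞) ≤ m := by
    intro a
    by_cases h0 : M a 0
    · obtain ⟨m, hm⟩ := SW_lower_nat {b | M a b} (fun b hb c hc => h2' a b c hc hb) h0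
      exact ⟨{m}, fun b => by simpa using hm b⟩
    · exact ⟨∅, fun b => by simpa using fun h => h0 (h2' a b 0 (Nat.zero_le _) h)⟩
  choose o ho using key
  -- stabilization
  let H : ℕ → ℕ∞ := fun a => ⨅ b : {b : ℕ // ¬ M a b}, (b : ℕ∞)
  have hH : ∀ a b, M a b ↔ (b : ℕ∞) < H a := by
    intro a b
    constructor
    · intro h
      have : ((b + 1 : ℕ) : ℕ∞) ≤ H a := by
        refine le_iInf fun c => ?_
        rw [Nat.cast_le]
        by_contra hc
        exact c.2 (h2' a b c (by omega) h)
      exact lt_of_lt_of_le (by rw [Nat.cast_lt]; omega) this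
    · intro h
      by_contra hc
      exact absurd h (not_lt.2 (iInf_le (fun b : {b : ℕ // ¬ M a b} => ((b : ℕ) : ℕ∞)) ⟨b, hc⟩))
  obtain ⟨N, hN⟩ : ∃ N, ∀ a, N ≤ a → H a = H N := by
    have hne : (Set.range H).Nonempty := ⟨_, 0, rfl⟩
    obtain ⟨_, ⟨N, rfl⟩, hN⟩ := WellFounded.has_min (wellFounded_lt (α := ℕ∞)) (Set.range H) hne
    refine ⟨N, fun a ha => le_antisymm ?_ ?_⟩
    · by_contra hlt
      rw [not_le] at hlt
      obtain ⟨b, hb⟩ := ENat.ne_top_iff_exists.1 hlt.ne_top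
      have h3 := (hH a b).2 (by rw [hb]; exact hlt)
      have h4 := (hH N b).1 (h1' a N b ha h3)
      rw [hb] at h4
      exact lt_irrefl _ h4
    · exact not_lt.1 (hN _ ⟨a, rfl⟩)
  refine ⟨(Finset.range N).biUnion (fun a => (o a).image fun m => ((a : ℕ∞), m)) ∪
    (o N).image fun m => ((⊤ : ℕ∞), m), fun a b => ?_⟩
  have hNN : ∀ a, N ≤ a → ∀ b, M a b ↔ M N b := fun a ha b => by rw [hH, hH, hN a ha]
  constructor
  · intro h
    by_cases ha : a < N
    · obtain ⟨m, hm, hbm⟩ := (ho a b).1 h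
      refine ⟨(a, m), ?_, le_rfl, hbm⟩
      simp only [Finset.mem_union, Finset.mem_biUnion, Finset.mem_image, Finset.mem_range]
      exact Or.inl ⟨a, ha, m, hm, rfl⟩
    · obtain ⟨m, hm, hbm⟩ := (ho N b).1 ((hNN a (by omega) b).1 h)
      refine ⟨(⊤, m), ?_, le_top, hbm⟩
      simp only [Finset.mem_union, Finset.mem_biUnion, Finset.mem_image, Finset.mem_range]
      exact Or.inr ⟨m, hm, rfl⟩
  · rintro ⟨p, hp, hap, hbp⟩
    simp only [Finset.mem_union, Finset.mem_biUnion, Finset.mem_image, Finset.mem_range] at hp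
    rcases hp with ⟨c, -, m, hm, rfl⟩ | ⟨m, hm, rfl⟩
    · exact h1' c a b (Nat.cast_le.1 hap) ((ho c b).2 ⟨m, hm, hbp⟩)
    · have h := (ho N b).2 ⟨m, hm, hbp⟩
      by_cases ha : N ≤ a
      · exact (hNN a ha b).2 h
      · exact h1' N a b (by omega) h

theorem SW_deriv (V : Submodule ℂ C(ℂ, ℂ)) (hV : IsClosed (V : Set C(ℂ, ℂ)))
    (φ : ℂ → ℂ) (hφ : ContDiff ℝ 1 φ) (p q r : C(ℂ, ℂ))
    (h : ∀ c : ℂ, ∃ g ∈ V, ∀ z, g z = p z * φ (c * q z + r z)) (c v : ℂ) :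
    ∃ g ∈ V, ∀ z, g z = p z * fderiv ℝ φ (c * q z + r z) (v * q z) := by
  have hc : Continuous (fderiv ℝ φ) := hφ.continuous_fderiv one_ne_zero
  let F : ℝ × ℂ → ℂ := fun x => p x.2 *
    ∫ s in (0:ℝ)..1, fderiv ℝ φ (c * q x.2 + r x.2 + ((s * x.1 : ℝ) : ℂ) * (v * q x.2)) (v * q x.2)
  have hF : Continuous F := by
    refine Continuous.mul (by fun_prop) ?_
    apply intervalIntegral.continuous_parametric_intervalIntegral_of_continuous'
    simp only [Function.uncurry_def]
    fun_prop
  let Φ : C(ℝ, C(ℂ, ℂ)) := ContinuousMap.curry ⟨F, hF⟩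
  have hne : ∀ t : ℝ, t ≠ 0 → Φ t ∈ V := by
    intro t ht
    obtain ⟨g1, hg1, e1⟩ := h (c + t * v)
    obtain ⟨g0, hg0, e0⟩ := h c
    have : Φ t = ((t : ℂ)⁻¹) • (g1 - g0) := by
      ext z
      simp only [Φ, F, ContinuousMap.curry_apply, ContinuousMap.coe_mk, ContinuousMap.smul_apply,
        ContinuousMap.sub_apply, e1, e0, smul_eq_mul]
      have key : ∫ s in (0:ℝ)..1, (t : ℂ) * fderiv ℝ φ (c * q z + r z + ((s * t : ℝ) : ℂ) * (v * q z)) (v * q z)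
          = φ (c * q z + r z + ((1 * t : ℝ) : ℂ) * (v * q z)) - φ (c * q z + r z + ((0 * t : ℝ) : ℂ) * (v * q z)) := by
        apply intervalIntegral.integral_eq_sub_of_hasDerivAt
          (f := fun s : ℝ => φ (c * q z + r z + ((s * t : ℝ) : ℂ) * (v * q z)))
        · intro s _
          have h1 : HasDerivAt (fun s : ℝ => c * q z + r z + ((s * t : ℝ) : ℂ) * (v * q z))
              ((t : ℂ) * (v * q z)) s := by
            have h2 := (((hasDerivAt_id s).mul_const t).ofReal_comp.mul_const (v * q z)).const_add
              (c * q z + r z)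
            simpa using h2
          have h3 := ((hφ.differentiable one_ne_zero _).hasFDerivAt).comp_hasDerivAt s h1
          convert! h3 using 1
          rw [← Complex.real_smul (x := t), ← Complex.real_smul (x := t), map_smul]
        · apply Continuous.intervalIntegrable
          fun_prop
      rw [intervalIntegral.integral_const_mul] at key
      have ht' : (t : ℂ) ≠ 0 := by exact_mod_cast ht
      rw [eq_inv_mul_iff_mul_eq₀ ht', mul_left_comm, key]
      simp only [one_mul, zero_mul, Complex.ofReal_zero, add_zero]
      rw [show (c + t * v) * q z + r z = c * q z + r z + t * (v * q z) by ring]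
      ring
    rw [this]
    exact V.smul_mem _ (V.sub_mem hg1 hg0)
  refine ⟨Φ 0, ?_, fun z => ?_⟩
  · have hd : (0:ℝ) ∈ closure {0}ᶜ := by simp
    have := map_mem_closure Φ.continuous hd (t := (V : Set C(ℂ, ℂ))) (fun t ht => hne t ht)
    rwa [hV.closure_eq] at this
  · simp [Φ, F]

open Filter Topology

open scoped ContDiff ComplexConjugate

noncomputable def SWdz (φ : ℂ → ℂ) (x : ℂ) : ℂ :=
  (fderiv ℝ φ x 1 - Complex.I * fderiv ℝ φ x Complex.I) / 2

noncomputable def SWdzb (φ : ℂ → ℂ) (x : ℂ) : ℂ :=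
  (fderiv ℝ φ x 1 + Complex.I * fderiv ℝ φ x Complex.I) / 2

theorem SW_fderiv_apply (φ : ℂ → ℂ) (x w : ℂ) :
    fderiv ℝ φ x w = SWdz φ x * w + SWdzb φ x * conj w := by
  have : fderiv ℝ φ x w = w.re * fderiv ℝ φ x 1 + w.im * fderiv ℝ φ x Complex.I := by
    have hw : w = w.re • (1 : ℂ) + w.im • Complex.I := by simp
    conv_lhs => rw [hw]
    rw [map_add, map_smul, map_smul, Complex.real_smul, Complex.real_smul]
  rw [this, SWdz, SWdzb]
  have h1 : conj w = w.re - w.im * Complex.I := by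
    apply Complex.ext <;> simp
  rw [h1]
  conv_rhs => rw [← Complex.re_add_im w]
  simp only [Complex.add_re, Complex.add_im, Complex.ofReal_re, Complex.ofReal_im, Complex.mul_re,
    Complex.mul_im, Complex.I_re, Complex.I_im]
  push_cast
  ring_nf
  simp only [Complex.I_sq]
  ring

theorem SW_smooth_dz (φ : ℂ → ℂ) (h : ContDiff ℝ ∞ φ) : ContDiff ℝ ∞ (SWdz φ) := by
  have h1 : ContDiff ℝ ∞ (fderiv ℝ φ) := h.fderiv_right (by simp)
  unfold SWdz
  fun_prop

theorem SW_smooth_dzb (φ : ℂ → ℂ) (h : ContDiff ℝ ∞ φ) : ContDiff ℝ ∞ (SWdzb φ) := by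
  have h1 : ContDiff ℝ ∞ (fderiv ℝ φ) := h.fderiv_right (by simp)
  unfold SWdzb
  fun_prop

theorem SW_deriv_dz (V : Submodule ℂ C(ℂ, ℂ)) (hV : IsClosed (V : Set C(ℂ, ℂ)))
    (φ : ℂ → ℂ) (hφ : ContDiff ℝ ∞ φ) (p q r : C(ℂ, ℂ))
    (h : ∀ c : ℂ, ∃ g ∈ V, ∀ z, g z = p z * φ (c * q z + r z)) (c : ℂ) :
    ∃ g ∈ V, ∀ z, g z = p z * q z * SWdz φ (c * q z + r z) := by
  have hφ1 : ContDiff ℝ 1 φ := hφ.of_le (by norm_cast)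
  obtain ⟨g1, hg1, e1⟩ := SW_deriv V hV φ hφ1 p q r h c 1
  obtain ⟨g2, hg2, e2⟩ := SW_deriv V hV φ hφ1 p q r h c Complex.I
  refine ⟨(1/2 : ℂ) • (g1 - Complex.I • g2),
    V.smul_mem _ (V.sub_mem hg1 (V.smul_mem _ hg2)), fun z => ?_⟩
  simp only [ContinuousMap.smul_apply, ContinuousMap.sub_apply, e1, e2, SW_fderiv_apply, smul_eq_mul,
    map_mul, Complex.conj_I, map_one]
  ring_nf
  simp only [Complex.I_sq]
  ring

theorem SW_deriv_dzb (V : Submodule ℂ C(ℂ, ℂ)) (hV : IsClosed (V : Set C(ℂ, ℂ)))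
    (φ : ℂ → ℂ) (hφ : ContDiff ℝ ∞ φ) (p q r : C(ℂ, ℂ))
    (h : ∀ c : ℂ, ∃ g ∈ V, ∀ z, g z = p z * φ (c * q z + r z)) (c : ℂ) :
    ∃ g ∈ V, ∀ z, g z = p z * conj (q z) * SWdzb φ (c * q z + r z) := by
  have hφ1 : ContDiff ℝ 1 φ := hφ.of_le (by norm_cast)
  obtain ⟨g1, hg1, e1⟩ := SW_deriv V hV φ hφ1 p q r h c 1
  obtain ⟨g2, hg2, e2⟩ := SW_deriv V hV φ hφ1 p q r h c Complex.I
  refine ⟨(1/2 : ℂ) • (g1 + Complex.I • g2),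
    V.smul_mem _ (V.add_mem hg1 (V.smul_mem _ hg2)), fun z => ?_⟩
  simp only [ContinuousMap.smul_apply, ContinuousMap.add_apply, e1, e2, SW_fderiv_apply, smul_eq_mul,
    map_mul, Complex.conj_I, map_one]
  ring_nf
  simp only [Complex.I_sq]
  ring

noncomputable def SWmono (a b : ℕ) : C(ℂ, ℂ) :=
  ⟨fun z => z ^ a * conj z ^ b, by fun_prop⟩

@[simp] theorem SWmono_apply (a b : ℕ) (z : ℂ) : SWmono a b z = z ^ a * conj z ^ b := rfl

theorem SW_hasFDerivAt_mono (a b : ℕ) (z : ℂ) :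
    HasFDerivAt (𝕜 := ℝ) (fun z : ℂ => z ^ a * conj z ^ b)
      (((a * z ^ (a - 1) * conj z ^ b) • ContinuousLinearMap.id ℝ ℂ) +
        (b * z ^ a * conj z ^ (b - 1)) • (Complex.conjCLE : ℂ →L[ℝ] ℂ)) z := by
  have h1 : HasFDerivAt (𝕜 := ℝ) (fun z : ℂ => z) (ContinuousLinearMap.id ℝ ℂ) z := hasFDerivAt_id z
  have h2 : HasFDerivAt (𝕜 := ℝ) (fun z : ℂ => conj z) (Complex.conjCLE : ℂ →L[ℝ] ℂ) z :=
    (Complex.conjCLE : ℂ →L[ℝ] ℂ).hasFDerivAt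
  have h3 := (h1.pow a).mul (h2.pow b)
  convert! h3 using 1
  ext w
  simp; ring

theorem SW_dz_mono (a b : ℕ) (z : ℂ) : SWdz (SWmono a b) z = a * z ^ (a - 1) * conj z ^ b := by
  have h := (SW_hasFDerivAt_mono a b z).fderiv
  change SWdz (fun z : ℂ => z ^ a * conj z ^ b) z = _
  rw [SWdz, h]
  simp
  ring_nf
  simp only [Complex.I_sq]
  ring

theorem SW_dzb_mono (a b : ℕ) (z : ℂ) : SWdzb (SWmono a b) z = b * z ^ a * conj z ^ (b - 1) := by
  have h := (SW_hasFDerivAt_mono a b z).fderiv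
  change SWdzb (fun z : ℂ => z ^ a * conj z ^ b) z = _
  rw [SWdzb, h]
  simp
  ring_nf
  simp only [Complex.I_sq]
  ring

theorem SW_smooth_mono (a b : ℕ) : ContDiff ℝ ∞ (SWmono a b) := by
  have h2 : ContDiff ℝ ∞ (fun z : ℂ => conj z) := (Complex.conjCLE : ℂ →L[ℝ] ℂ).contDiff
  change ContDiff ℝ ∞ (fun z : ℂ => z ^ a * conj z ^ b)
  fun_prop

theorem SW_lower1 (V : Submodule ℂ C(ℂ, ℂ)) (hV : IsClosed (V : Set C(ℂ, ℂ)))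
    (hVinv : ∀ a b : ℂ, ∀ f ∈ V, ∀ g : C(ℂ, ℂ), (∀ z : ℂ, g z = f (a * z + b)) → g ∈ V)
    (a b : ℕ) (h : SWmono (a + 1) b ∈ V) : SWmono a b ∈ V := by
  obtain ⟨g, hg, e⟩ := SW_deriv_dz V hV (SWmono (a + 1) b) (SW_smooth_mono _ _) 1 1
    (ContinuousMap.id ℂ) (fun c => ⟨(SWmono (a + 1) b).comp ⟨fun z => 1 * z + c, by fun_prop⟩,
      hVinv 1 c _ h _ (fun z => rfl), fun z => by simp [add_comm]⟩) 0
  have : SWmono a b = ((a + 1 : ℂ)⁻¹) • g := by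
    ext z
    have ha : (a + 1 : ℂ) ≠ 0 := by exact_mod_cast Nat.succ_ne_zero a
    simp [e, SW_dz_mono]
    field_simp
  rw [this]
  exact V.smul_mem _ hg

theorem SW_lower2 (V : Submodule ℂ C(ℂ, ℂ)) (hV : IsClosed (V : Set C(ℂ, ℂ)))
    (hVinv : ∀ a b : ℂ, ∀ f ∈ V, ∀ g : C(ℂ, ℂ), (∀ z : ℂ, g z = f (a * z + b)) → g ∈ V)
    (a b : ℕ) (h : SWmono a (b + 1) ∈ V) : SWmono a b ∈ V := by
  obtain ⟨g, hg, e⟩ := SW_deriv_dzb V hV (SWmono a (b + 1)) (SW_smooth_mono _ _) 1 1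
    (ContinuousMap.id ℂ) (fun c => ⟨(SWmono a (b + 1)).comp ⟨fun z => 1 * z + c, by fun_prop⟩,
      hVinv 1 c _ h _ (fun z => rfl), fun z => by simp [add_comm]⟩) 0
  have : SWmono a b = ((b + 1 : ℂ)⁻¹) • g := by
    ext z
    have ha : (b + 1 : ℂ) ≠ 0 := by exact_mod_cast Nat.succ_ne_zero b
    simp [e, SW_dzb_mono]
    field_simp
  rw [this]
  exact V.smul_mem _ hg

theorem SW_smooth_iter (F : ℂ → ℂ) (hF : ContDiff ℝ ∞ F) (i j : ℕ) :
    ContDiff ℝ ∞ (SWdz^[i] (SWdzb^[j] F)) := by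
  induction i with
  | zero =>
    induction j with
    | zero => exact hF
    | succ j ih =>
      simp only [Function.iterate_succ_apply', Function.iterate_zero, id] at ih ⊢
      exact SW_smooth_dzb _ ih
  | succ i ih =>
    simp only [Function.iterate_succ_apply'] at ih ⊢
    exact SW_smooth_dz _ ih

theorem SW_iter (V : Submodule ℂ C(ℂ, ℂ)) (hV : IsClosed (V : Set C(ℂ, ℂ)))
    (hVinv : ∀ a b : ℂ, ∀ f ∈ V, ∀ g : C(ℂ, ℂ), (∀ z : ℂ, g z = f (a * z + b)) → g ∈ V)
    (F : C(ℂ, ℂ)) (hF : ContDiff ℝ ∞ F) (hFV : F ∈ V) (b : ℂ) (i j : ℕ) :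
    ∀ c : ℂ, ∃ g ∈ V, ∀ z, g z = SWmono i j z * (SWdz^[i] (SWdzb^[j] F)) (c * z + b) := by
  induction i with
  | zero =>
    induction j with
    | zero =>
      intro c
      exact ⟨F.comp ⟨fun z => c * z + b, by fun_prop⟩, hVinv c b _ hFV _ (fun z => rfl),
        fun z => by simp⟩
    | succ j ih =>
      intro c
      obtain ⟨g, hg, e⟩ := SW_deriv_dzb V hV _ (SW_smooth_iter F hF 0 j) (SWmono 0 j)
        (ContinuousMap.id ℂ) (ContinuousMap.const ℂ b) ih c
      refine ⟨g, hg, fun z => ?_⟩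
      rw [e]
      simp [Function.iterate_succ_apply', pow_succ]
  | succ i ih =>
    intro c
    obtain ⟨g, hg, e⟩ := SW_deriv_dz V hV _ (SW_smooth_iter F hF i j) (SWmono i j)
      (ContinuousMap.id ℂ) (ContinuousMap.const ℂ b) ih c
    refine ⟨g, hg, fun z => ?_⟩
    rw [e]
    simp only [Function.iterate_succ_apply', pow_succ, SWmono_apply, ContinuousMap.id_apply,
      ContinuousMap.const_apply]
    ring

theorem SW_mono_mem (V : Submodule ℂ C(ℂ, ℂ)) (hV : IsClosed (V : Set C(ℂ, ℂ)))
    (hVinv : ∀ a b : ℂ, ∀ f ∈ V, ∀ g : C(ℂ, ℂ), (∀ z : ℂ, g z = f (a * z + b)) → g ∈ V)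
    (F : C(ℂ, ℂ)) (hF : ContDiff ℝ ∞ F) (hFV : F ∈ V) (b : ℂ) (i j : ℕ)
    (hne : (SWdz^[i] (SWdzb^[j] F)) b ≠ 0) : SWmono i j ∈ V := by
  obtain ⟨g, hg, e⟩ := SW_iter V hV hVinv F hF hFV b i j 0
  have : SWmono i j = ((SWdz^[i] (SWdzb^[j] F)) b)⁻¹ • g := by
    ext z
    rw [ContinuousMap.smul_apply, e, smul_eq_mul, zero_mul, zero_add]
    field_simp
  rw [this]
  exact V.smul_mem _ hg

open Filter Topology

open scoped ContDiff ComplexConjugate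

structure SWP (F : ℂ → ℂ) (c : ℕ × ℕ → ℂ) : Prop where
  summ : ∀ R : ℝ, 1 ≤ R → Summable fun p : ℕ × ℕ => ‖c p‖ * R ^ (p.1 + p.2)
  hasSum : ∀ z : ℂ, HasSum (fun p : ℕ × ℕ => c p * (z ^ p.1 * conj z ^ p.2)) (F z)

theorem SWP.add {F G : ℂ → ℂ} {c d : ℕ × ℕ → ℂ} (hF : SWP F c) (hG : SWP G d) :
    SWP (fun z => F z + G z) (fun p => c p + d p) := by
  refine ⟨fun R hR => ?_, fun z => ?_⟩
  · refine Summable.of_nonneg_of_le (fun p => by positivity) (fun p => ?_)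
      ((hF.summ R hR).add (hG.summ R hR))
    rw [← add_mul]
    gcongr
    exact norm_add_le _ _
  · simpa [add_mul] using (hF.hasSum z).add (hG.hasSum z)

theorem SWP.conj {F : ℂ → ℂ} {c : ℕ × ℕ → ℂ} (hF : SWP F c) :
    SWP (fun z => conj (F z)) (fun p => conj (c p.swap)) := by
  refine ⟨fun R hR => ?_, fun z => ?_⟩
  · have := (Equiv.prodComm ℕ ℕ).summable_iff.2 (hF.summ R hR)
    refine this.congr fun p => ?_
    simp [add_comm]
  · have h1 : HasSum (fun p : ℕ × ℕ => conj (c p * (z ^ p.1 * conj z ^ p.2))) (conj (F z)) :=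
      (hF.hasSum z).mapL (Complex.conjCLE : ℂ →L[ℝ] ℂ)
    have := (Equiv.prodComm ℕ ℕ).hasSum_iff.2 h1
    refine this.congr_fun fun p => ?_
    simp [mul_comm]

theorem SWdz_conj (F : ℂ → ℂ) (z : ℂ) : SWdz F z = conj (SWdzb (fun z => conj (F z)) z) := by
  have h : fderiv ℝ (fun z => conj (F z)) z = (Complex.conjCLE : ℂ →L[ℝ] ℂ).comp (fderiv ℝ F z) :=
    Complex.conjCLE.comp_fderiv (f := F) (x := z)
  have h2 : conj (2 : ℂ) = 2 := map_ofNat _ 2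
  rw [SWdz, SWdzb, h]
  simp [h2]
  ring

theorem SWP.of_summ {c : ℕ × ℕ → ℂ}
    (h : ∀ R : ℝ, 1 ≤ R → Summable fun p : ℕ × ℕ => ‖c p‖ * R ^ (p.1 + p.2)) :
    SWP (fun z => ∑' p : ℕ × ℕ, c p * (z ^ p.1 * (starRingEnd ℂ) z ^ p.2)) c := by
  refine ⟨h, fun z => Summable.hasSum ?_⟩
  refine Summable.of_norm_bounded (h (max 1 ‖z‖) (le_max_left _ _)) fun p => ?_
  rw [norm_mul, norm_mul, norm_pow, norm_pow, RCLike.norm_conj, ← pow_add]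
  gcongr
  exact le_max_right _ _

theorem SWP.deriv {F : ℂ → ℂ} {c : ℕ × ℕ → ℂ} (hF : SWP F c) (z : ℂ) :
    DifferentiableAt ℝ F z ∧
    HasSum (fun p : ℕ × ℕ => c p * (p.2 * z ^ p.1 * (starRingEnd ℂ) z ^ (p.2 - 1))) (SWdzb F z) := by
  obtain ⟨R, hR1, hzR⟩ : ∃ R : ℝ, 1 ≤ R ∧ ‖z‖ < R :=
    ⟨‖z‖ + 1, by linarith [norm_nonneg z], by linarith⟩
  let f' : ℕ × ℕ → ℂ → ℂ →L[ℝ] ℂ := fun p z => c p •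
    (((p.1 * z ^ (p.1 - 1) * (starRingEnd ℂ) z ^ p.2) • ContinuousLinearMap.id ℝ ℂ) +
        (p.2 * z ^ p.1 * (starRingEnd ℂ) z ^ (p.2 - 1)) • (Complex.conjCLE : ℂ →L[ℝ] ℂ))
  have hb : ∀ (p : ℕ × ℕ) (x : ℂ), x ∈ Metric.ball (0:ℂ) R →
      ‖f' p x‖ ≤ ‖c p‖ * (2 * R) ^ (p.1 + p.2) := by
    intro p x hx
    have hxR : ‖x‖ ≤ R := by simpa using (Metric.mem_ball.1 hx).le
    have hid : ‖ContinuousLinearMap.id ℝ ℂ‖ ≤ 1 := ContinuousLinearMap.norm_id_le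
    have hcj : ‖(Complex.conjCLE : ℂ →L[ℝ] ℂ)‖ ≤ 1 := by
      refine ContinuousLinearMap.opNorm_le_bound _ zero_le_one fun w => by simp
    have h1 : ‖((p.1 : ℂ) * x ^ (p.1 - 1) * (starRingEnd ℂ) x ^ p.2)‖ ≤ p.1 * R ^ (p.1 + p.2) := by
      rw [norm_mul, norm_mul, norm_pow, norm_pow, RCLike.norm_conj, Complex.norm_natCast, mul_assoc,
        ← pow_add]
      gcongr
      calc ‖x‖ ^ (p.1 - 1 + p.2) ≤ R ^ (p.1 - 1 + p.2) := by gcongr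
        _ ≤ _ := pow_le_pow_right₀ hR1 (by omega)
    have h2 : ‖((p.2 : ℂ) * x ^ p.1 * (starRingEnd ℂ) x ^ (p.2 - 1))‖ ≤ p.2 * R ^ (p.1 + p.2) := by
      rw [norm_mul, norm_mul, norm_pow, norm_pow, RCLike.norm_conj, Complex.norm_natCast, mul_assoc,
        ← pow_add]
      gcongr
      calc ‖x‖ ^ (p.1 + (p.2 - 1)) ≤ R ^ (p.1 + (p.2 - 1)) := by gcongr
        _ ≤ _ := pow_le_pow_right₀ hR1 (by omega)
    have h3 : ((p.1 + p.2 : ℕ) : ℝ) ≤ 2 ^ (p.1 + p.2) := by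
      exact_mod_cast (Nat.lt_two_pow_self).le
    rw [norm_smul]
    gcongr
    calc _ ≤ _ := norm_add_le _ _
      _ ≤ (p.1 * R ^ (p.1 + p.2)) * 1 + (p.2 * R ^ (p.1 + p.2)) * 1 := by
        rw [norm_smul, norm_smul]
        gcongr
      _ = ((p.1 + p.2 : ℕ) : ℝ) * R ^ (p.1 + p.2) := by push_cast; ring
      _ ≤ 2 ^ (p.1 + p.2) * R ^ (p.1 + p.2) := by gcongr
      _ = _ := by rw [mul_pow]
  have hu := hF.summ (2 * R) (by linarith)
  have hz : z ∈ Metric.ball (0:ℂ) R := by simpa using hzR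
  have key := hasFDerivAt_tsum_of_isPreconnected (𝕜 := ℝ) (x₀ := z) hu Metric.isOpen_ball
    (convex_ball (0:ℂ) R).isPreconnected
    (f := fun p z => c p * (z ^ p.1 * (starRingEnd ℂ) z ^ p.2)) (f' := f')
    (fun p x _ => (SW_hasFDerivAt_mono p.1 p.2 x).const_mul (c p)) hb hz (hF.hasSum z).summable hz
  have hFe : (fun z => ∑' p : ℕ × ℕ, c p * (z ^ p.1 * (starRingEnd ℂ) z ^ p.2)) = F := by
    ext z; exact (hF.hasSum z).tsum_eq
  rw [hFe] at key
  refine ⟨key.differentiableAt, ?_⟩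
  have hs : HasSum (fun p => f' p z) (fderiv ℝ F z) := by
    rw [key.fderiv]
    exact (Summable.of_norm_bounded hu fun p => hb p z hz).hasSum
  have hs1 := hs.mapL (ContinuousLinearMap.apply ℝ ℂ (1:ℂ))
  have hsI := hs.mapL (ContinuousLinearMap.apply ℝ ℂ Complex.I)
  have := (hs1.add (hsI.mul_left Complex.I)).div_const 2
  refine this.congr_fun fun p => ?_
  simp [f']
  ring_nf
  simp only [Complex.I_sq]
  ring

theorem SW_inj2 : Function.Injective (fun p : ℕ × ℕ => (p.1, p.2 + 1)) := by
  rintro ⟨a, b⟩ ⟨c, d⟩ h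
  simpa using h

theorem SWP.dzb {F : ℂ → ℂ} {c : ℕ × ℕ → ℂ} (hF : SWP F c) :
    SWP (SWdzb F) (fun p => (p.2 + 1) * c (p.1, p.2 + 1)) := by
  refine ⟨fun R hR => ?_, fun z => ?_⟩
  · have h := (hF.summ (2 * R) (by linarith)).comp_injective SW_inj2
    refine Summable.of_nonneg_of_le (fun p => by positivity) (fun p => ?_) h
    have h3 : ((p.2 + 1 : ℕ) : ℝ) ≤ 2 ^ (p.1 + (p.2 + 1)) := by
      have : p.2 + 1 < 2 ^ (p.2 + 1) := Nat.lt_two_pow_self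
      have h4 : 2 ^ (p.2 + 1) ≤ 2 ^ (p.1 + (p.2 + 1)) := Nat.pow_le_pow_right (by norm_num) (by omega)
      exact_mod_cast this.le.trans h4
    have h5 : ‖((p.2 : ℂ) + 1)‖ = ((p.2 + 1 : ℕ) : ℝ) := by
      rw [← Complex.norm_natCast]; push_cast; rfl
    rw [norm_mul, h5, Function.comp_apply, mul_pow]
    calc _ = ‖c (p.1, p.2 + 1)‖ * (((p.2 + 1 : ℕ) : ℝ) * R ^ (p.1 + p.2)) := by ring
      _ ≤ _ := by
        gcongr
        omega
  · have h := (hF.deriv z).2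
    rw [← SW_inj2.hasSum_iff] at h
    · refine h.congr_fun fun p => ?_
      simp
      ring
    · rintro ⟨a, b⟩ hp
      cases b with
      | zero => simp
      | succ b => exact absurd ⟨(a, b), rfl⟩ hp

theorem SWP.dz {F : ℂ → ℂ} {c : ℕ × ℕ → ℂ} (hF : SWP F c) :
    SWP (SWdz F) (fun p => (p.1 + 1) * c (p.1 + 1, p.2)) := by
  have h := hF.conj.dzb.conj
  have e : SWdz F = fun z => (starRingEnd ℂ) (SWdzb (fun z => (starRingEnd ℂ) (F z)) z) :=
    funext fun z => SWdz_conj F z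
  rw [e]
  convert! h using 1
  ext p
  simp

theorem SW_antideriv_dzb {F : ℂ → ℂ} {c : ℕ × ℕ → ℂ} (hF : Differentiable ℝ F)
    (h : SWP (SWdzb F) c) : ∃ d, SWP F d := by
  let c' : ℕ × ℕ → ℂ := fun p => if p.2 = 0 then 0 else c (p.1, p.2 - 1) / p.2
  have hc' : ∀ p : ℕ × ℕ, c' (p.1, p.2 + 1) = c p / (p.2 + 1) := fun p => by simp [c']
  have hs : ∀ R : ℝ, 1 ≤ R → Summable fun p : ℕ × ℕ => ‖c' p‖ * R ^ (p.1 + p.2) := by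
    intro R hR
    rw [← SW_inj2.summable_iff]
    · refine Summable.of_nonneg_of_le (fun p => by simp only [Function.comp]; positivity)
        (fun p => ?_) ((h.summ R hR).mul_right R)
      simp only [Function.comp, hc']
      have h5 : ‖((p.2 : ℂ) + 1)‖ = ((p.2 + 1 : ℕ) : ℝ) := by
        rw [← Complex.norm_natCast]; push_cast; rfl
      rw [norm_div, h5, ← add_assoc, pow_succ, ← mul_assoc]
      gcongr
      apply div_le_self (norm_nonneg _)
      push_cast
      linarith [(Nat.cast_nonneg p.2 : (0:ℝ) ≤ p.2)]
    · rintro ⟨a, b⟩ hp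
      cases b with
      | zero => simp [c']
      | succ b => exact absurd ⟨(a, b), rfl⟩ hp
  have hG := SWP.of_summ hs
  generalize (fun z => ∑' p : ℕ × ℕ, c' p * (z ^ p.1 * (starRingEnd ℂ) z ^ p.2)) = G at hG
  have hGd : Differentiable ℝ G := fun z => (hG.deriv z).1
  have hdz : ∀ z, SWdzb G z = SWdzb F z := by
    intro z
    refine (hG.dzb.hasSum z).unique ((h.hasSum z).congr_fun fun p => ?_)
    rw [hc']
    have ha : (p.2 + 1 : ℂ) ≠ 0 := by exact_mod_cast Nat.succ_ne_zero p.2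
    field_simp
  let E : ℂ → ℂ := fun z => F z - G z
  have hE : Differentiable ℂ E := by
    intro z
    have h1 : HasFDerivAt (𝕜 := ℝ) E (fderiv ℝ F z - fderiv ℝ G z) z :=
      (hF z).hasFDerivAt.sub (hGd z).hasFDerivAt
    have h2 : HasFDerivAt (𝕜 := ℂ) E ((SWdz F z - SWdz G z) • ContinuousLinearMap.id ℂ ℂ) z := by
      refine hasFDerivAt_of_restrictScalars ℝ h1 ?_
      refine ContinuousLinearMap.ext fun w => ?_
      rw [sub_apply, SW_fderiv_apply, SW_fderiv_apply, hdz]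
      simp
      ring
    exact h2.differentiableAt
  let a : ℕ → ℂ := fun n => (n.factorial : ℂ)⁻¹ * iteratedDeriv n E 0
  have ha : ∀ z, HasSum (fun n => a n * z ^ n) (E z) := by
    intro z
    have := Complex.hasSum_taylorSeries_of_entire hE 0 z
    refine this.congr_fun fun n => ?_
    simp [a]
    ring
  have hinj : Function.Injective (fun n : ℕ => (n, 0)) := fun a b h => by simpa using h
  let c2 : ℕ × ℕ → ℂ := fun p => if p.2 = 0 then a p.1 else 0
  have hout : ∀ p : ℕ × ℕ, p ∉ Set.range (fun n : ℕ => (n, 0)) → c2 p = 0 := by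
    rintro ⟨x, b⟩ hp
    cases b with
    | zero => exact absurd ⟨x, rfl⟩ hp
    | succ b => simp [c2]
  have hE2 : SWP E c2 := by
    refine ⟨fun R hR => ?_, fun z => ?_⟩
    · rw [← hinj.summable_iff]
      · have := (ha R).summable.norm
        refine this.congr fun n => ?_
        simp [c2, abs_of_nonneg (zero_le_one.trans hR)]
      · intro p hp
        simp [hout p hp]
    · rw [← hinj.hasSum_iff]
      · refine (ha z).congr_fun fun n => ?_
        simp [c2]
      · intro p hp
        simp [hout p hp]
  have := hE2.add hG
  simp only [E, sub_add_cancel] at this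
  exact ⟨_, this⟩

theorem SW_antideriv_dz {F : ℂ → ℂ} {c : ℕ × ℕ → ℂ} (hF : Differentiable ℝ F)
    (h : SWP (SWdz F) c) : ∃ d, SWP F d := by
  have e : (fun z => (starRingEnd ℂ) (SWdz F z)) = SWdzb (fun z => (starRingEnd ℂ) (F z)) :=
    funext fun z => by rw [SWdz_conj]; simp
  have h1 := h.conj
  rw [e] at h1
  obtain ⟨d, hd⟩ := SW_antideriv_dzb
    (fun z => ((Complex.conjCLE : ℂ →L[ℝ] ℂ).differentiableAt.comp z (hF z))) h1
  have h2 := hd.conj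
  have e2 : (fun z => (starRingEnd ℂ) ((Complex.conjCLE : ℂ →L[ℝ] ℂ) (F z))) = F :=
    funext fun z => by simp
  exact ⟨_, e2 ▸ h2⟩

theorem SW_exists_SWP {F : ℂ → ℂ} (hF : ContDiff ℝ ∞ F) (i j : ℕ)
    (h : ∀ z, (SWdz^[i] (SWdzb^[j] F)) z = 0) : ∃ d, SWP F d := by
  have h0 : ∃ d, SWP (SWdz^[i] (SWdzb^[j] F)) d :=
    ⟨fun _ => 0, ⟨fun R _ => by simp, fun z => by simp [h]⟩⟩
  have hd : ∀ i j, Differentiable ℝ (SWdz^[i] (SWdzb^[j] F)) := fun i j =>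
    (SW_smooth_iter F hF i j).differentiable (by simp)
  clear h
  induction i with
  | zero =>
    induction j with
    | zero => exact h0
    | succ j ih =>
      apply ih
      obtain ⟨d, h0⟩ := h0
      simp only [Function.iterate_succ_apply', Function.iterate_zero, id] at h0
      exact SW_antideriv_dzb (hd 0 j) h0
  | succ i ih =>
    apply ih
    obtain ⟨d, h0⟩ := h0
    simp only [Function.iterate_succ_apply'] at h0
    exact SW_antideriv_dz (hd i j) h0

theorem SW_coeff {F : ℂ → ℂ} {c : ℕ × ℕ → ℂ} (hF : SWP F c) (i j : ℕ) (hc : c (i, j) ≠ 0) :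
    (SWdz^[i] (SWdzb^[j] F)) 0 ≠ 0 := by
  have key : ∀ i j, ∃ d, SWP (SWdz^[i] (SWdzb^[j] F)) d ∧
      ∀ p : ℕ × ℕ, c (p.1 + i, p.2 + j) ≠ 0 → d p ≠ 0 := by
    intro i j
    induction i with
    | zero =>
      induction j with
      | zero => exact ⟨c, hF, fun p hp => hp⟩
      | succ j ih =>
        obtain ⟨d, h0, h1⟩ := ih
        simp only [Function.iterate_succ_apply', Function.iterate_zero, id] at h0 ⊢
        refine ⟨_, h0.dzb, fun p hp => mul_ne_zero (by exact_mod_cast Nat.succ_ne_zero p.2) ?_⟩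
        apply h1
        convert hp using 3
        simp; omega
    | succ i ih =>
      obtain ⟨d, h0, h1⟩ := ih
      simp only [Function.iterate_succ_apply'] at h0 ⊢
      refine ⟨_, h0.dz, fun p hp => mul_ne_zero (by exact_mod_cast Nat.succ_ne_zero p.1) ?_⟩
      apply h1
      convert hp using 3
      simp; omega
  obtain ⟨d, h0, h1⟩ := key i j
  have h2 := h0.hasSum 0
  have h3 := hasSum_single (f := fun p : ℕ × ℕ => d p * ((0:ℂ) ^ p.1 * (starRingEnd ℂ) 0 ^ p.2)) (0, 0)
    (by
      rintro ⟨a, b⟩ hab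
      have : a ≠ 0 ∨ b ≠ 0 := by
        by_contra hh
        push Not at hh
        exact hab (by rw [hh.1, hh.2])
      rcases this with h | h <;> simp [h])
  rw [h2.unique h3]
  simpa using h1 (0, 0) (by simpa using hc)

theorem SWP.mem_closure {F : C(ℂ, ℂ)} {c : ℕ × ℕ → ℂ} (hF : SWP F c) (S : Submodule ℂ C(ℂ, ℂ))
    (hS : ∀ p : ℕ × ℕ, c p ≠ 0 → SWmono p.1 p.2 ∈ S) : F ∈ closure (S : Set C(ℂ, ℂ)) := by
  apply SW_mem_closure
  intro K hK ε hε
  obtain ⟨R, hR⟩ := hK.isBounded.exists_norm_le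
  have hu := hF.summ (max 1 R) (le_max_left _ _)
  have h := tendstoUniformlyOn_tsum (s := K)
    (f := fun (p : ℕ × ℕ) (z : ℂ) => c p * (z ^ p.1 * (starRingEnd ℂ) z ^ p.2)) hu (by
      intro p z hz
      rw [norm_mul, norm_mul, norm_pow, norm_pow, RCLike.norm_conj, ← pow_add]
      gcongr
      exact (hR z hz).trans (le_max_right _ _))
  rw [Metric.tendstoUniformlyOn_iff] at h
  obtain ⟨t, ht⟩ := (h ε hε).exists
  refine ⟨∑ p ∈ t, c p • SWmono p.1 p.2, S.sum_mem fun p _ => ?_, fun z hz => ?_⟩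
  · by_cases hp : c p = 0
    · have h0 : c p • SWmono p.1 p.2 = 0 := by
        ext z
        simp [hp]
      rw [h0]
      exact S.zero_mem
    · exact S.smul_mem _ (hS p hp)
  · have := ht z hz
    rw [(hF.hasSum z).tsum_eq] at this
    simpa [ContinuousMap.sum_apply] using this

open Filter Topology

open scoped ContDiff ComplexConjugate Convolution

open MeasureTheory

theorem SW_dense (S : Submodule ℂ C(ℂ, ℂ)) (hS : ∀ a b, SWmono a b ∈ S) (f : C(ℂ, ℂ)) :
    f ∈ closure (S : Set C(ℂ, ℂ)) := by
  apply SW_mem_closure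
  intro K hK ε hε
  have : CompactSpace K := isCompact_iff_compactSpace.1 hK
  have h1 := ContinuousMap.elemental_id_eq_top (𝕜 := ℂ) K
  set x : C(K, ℂ) := ContinuousMap.restrict K (.id ℂ) with hx
  have h2 : f.restrict K ∈ StarAlgebra.elemental ℂ x := by rw [h1]; trivial
  have h3 : f.restrict K ∈ closure ((StarAlgebra.adjoin ℂ {x} : StarSubalgebra ℂ C(K, ℂ)) : Set C(K, ℂ)) := h2
  obtain ⟨g, hg, hfg⟩ := Metric.mem_closure_iff.1 h3 ε hε
  have key : ∀ g ∈ StarAlgebra.adjoin ℂ {x}, ∃ h ∈ S, ∀ z : K, h z = g z := by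
    intro g hg
    have hg2 : g ∈ Algebra.adjoin ℂ ({x} ∪ star {x} : Set C(K, ℂ)) := by
      rw [← StarAlgebra.adjoin_toSubalgebra]; exact hg
    clear hg
    rw [← Subalgebra.mem_toSubmodule, Algebra.adjoin_eq_span] at hg2
    induction hg2 using Submodule.span_induction with
    | mem y hy =>
      have : ∃ a b : ℕ, y = x ^ a * (star x) ^ b := by
        induction hy using Submonoid.closure_induction with
        | mem y hy =>
          rcases hy with hy | hy
          · rw [Set.mem_singleton_iff] at hy
            exact ⟨1, 0, by simp [hy]⟩
          · rw [Set.mem_star, Set.mem_singleton_iff] at hy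
            exact ⟨0, 1, by simp [← hy]⟩
        | one => exact ⟨0, 0, by simp⟩
        | mul u v _ _ hu hv =>
          obtain ⟨a, b, rfl⟩ := hu
          obtain ⟨c, d, rfl⟩ := hv
          exact ⟨a + c, b + d, by ring⟩
      obtain ⟨a, b, rfl⟩ := this
      exact ⟨SWmono a b, hS a b, fun z => by simp [hx]⟩
    | zero => exact ⟨0, S.zero_mem, fun z => by simp⟩
    | add u v _ _ hu hv =>
      obtain ⟨h, hh, e⟩ := hu
      obtain ⟨h', hh', e'⟩ := hv
      exact ⟨h + h', S.add_mem hh hh', fun z => by simp [e, e']⟩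
    | smul r u _ hu =>
      obtain ⟨h, hh, e⟩ := hu
      exact ⟨r • h, S.smul_mem r hh, fun z => by simp [e]⟩
  obtain ⟨h, hh, e⟩ := key g hg
  refine ⟨h, hh, fun z hz => ?_⟩
  rw [e ⟨z, hz⟩]
  exact lt_of_le_of_lt (ContinuousMap.dist_apply_le_dist (f := f.restrict K) (g := g) ⟨z, hz⟩) hfg

theorem SW_integral_mem (V : Submodule ℂ C(ℂ, ℂ)) (hV : IsClosed (V : Set C(ℂ, ℂ)))
    (hVinv : ∀ a b : ℂ, ∀ f ∈ V, ∀ g : C(ℂ, ℂ), (∀ z : ℂ, g z = f (a * z + b)) → g ∈ V)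
    (f : C(ℂ, ℂ)) (hf : f ∈ V) (φ : ℂ → ℝ) (hφ : Continuous φ) (hφs : HasCompactSupport φ)
    (F : C(ℂ, ℂ)) (hF : ∀ z, F z = ∫ t, φ t • f (z - t)) : F ∈ V := by
  rw [← SetLike.mem_coe, ← hV.closure_eq]
  apply SW_mem_closure
  intro K hK ε hε
  have : CompactSpace K := isCompact_iff_compactSpace.1 hK
  let ρ : C(ℂ, ℂ) →ₗ[ℂ] C(K, ℂ) :=
    { toFun := fun g => g.restrict K
      map_add' := fun _ _ => rfl
      map_smul' := fun _ _ => rfl }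
  let W : Submodule ℂ C(K, ℂ) := (V.map ρ).topologicalClosure
  have hWc : IsClosed (W : Set C(K, ℂ)) := Submodule.isClosed_topologicalClosure _
  have : CompleteSpace W := hWc.completeSpace_coe
  let Φ0 : C(ℂ, C(K, ℂ)) := ContinuousMap.curry ⟨fun x : ℂ × K => f (x.2 - x.1), by fun_prop⟩
  have hΦ0 : ∀ t, Φ0 t ∈ W := by
    intro t
    apply Submodule.le_topologicalClosure
    refine ⟨f.comp ⟨fun z => z - t, by fun_prop⟩, ?_, ?_⟩
    · exact hVinv 1 (-t) f hf _ (fun z => by simp [sub_eq_add_neg])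
    · ext z; rfl
  let Φ : ℂ → W := fun t => φ t • ⟨Φ0 t, hΦ0 t⟩
  have hΦc : Continuous Φ := by
    refine hφ.smul ?_
    exact Φ0.continuous.subtype_mk _
  have hΦs : HasCompactSupport Φ := hφs.smul_right
  have hInteg : Integrable Φ := hΦc.integrable_of_hasCompactSupport hΦs
  have h1 : ∫ t, (Φ t : C(K, ℂ)) = ((∫ t, Φ t : W) : C(K, ℂ)) :=
    (W.subtypeL.restrictScalars ℝ).integral_comp_comm hInteg
  have hInteg2 : Integrable (fun t => (Φ t : C(K, ℂ))) :=
    (W.subtypeL.restrictScalars ℝ).integrable_comp hInteg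
  have h2 : ∀ z : K, (∫ t, (Φ t : C(K, ℂ))) z = F z := by
    intro z
    rw [ContinuousMap.integral_apply hInteg2, hF]
    rfl
  have h3 : (∫ t, (Φ t : C(K, ℂ))) ∈ closure ((V.map ρ : Submodule ℂ C(K, ℂ)) : Set C(K, ℂ)) := by
    rw [h1]
    exact (∫ t, Φ t : W).2
  obtain ⟨_, ⟨g, hg, rfl⟩, hfg⟩ := Metric.mem_closure_iff.1 h3 ε hε
  refine ⟨g, hg, fun z hz => ?_⟩
  rw [← h2 ⟨z, hz⟩]
  exact lt_of_le_of_lt (ContinuousMap.dist_apply_le_dist (g := ρ g) ⟨z, hz⟩) hfg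

theorem SW_smooth_dense (V : Submodule ℂ C(ℂ, ℂ)) (hV : IsClosed (V : Set C(ℂ, ℂ)))
    (hVinv : ∀ a b : ℂ, ∀ f ∈ V, ∀ g : C(ℂ, ℂ), (∀ z : ℂ, g z = f (a * z + b)) → g ∈ V)
    (f : C(ℂ, ℂ)) (hf : f ∈ V) : f ∈ closure {F : C(ℂ, ℂ) | F ∈ V ∧ ContDiff ℝ ∞ F} := by
  apply SW_mem_closure
  intro K hK ε hε
  -- uniform continuity near K
  obtain ⟨δ, hδ, hu⟩ : ∃ δ > 0, ∀ z ∈ K, ∀ w, dist w z < δ → dist (f w) (f z) < ε / 2 := by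
    have hK1 : IsCompact (Metric.cthickening 1 K) := hK.cthickening
    have huc := hK1.uniformContinuousOn_of_continuous f.continuous.continuousOn
    obtain ⟨δ, hδ, h⟩ := Metric.uniformContinuousOn_iff.1 huc (ε / 2) (by positivity)
    refine ⟨min δ 1, by positivity, fun z hz w hw => ?_⟩
    refine h w ?_ z ?_ (hw.trans_le (min_le_left _ _))
    · exact Metric.mem_cthickening_of_dist_le w z 1 K hz (hw.le.trans (min_le_right _ _))
    · exact Metric.self_subset_cthickening K hz
  let φ : ContDiffBump (0 : ℂ) := ⟨δ / 2, δ, by positivity, by linarith⟩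
  have hsm : ContDiff ℝ ∞ (φ.normed volume ⋆[ContinuousLinearMap.lsmul ℝ ℝ, volume] f) :=
    φ.hasCompactSupport_normed.contDiff_convolution_left _ φ.contDiff_normed
      f.continuous.locallyIntegrable
  refine ⟨⟨_, hsm.continuous⟩, ⟨?_, hsm⟩, fun z hz => ?_⟩
  · exact SW_integral_mem V hV hVinv f hf (φ.normed volume) φ.continuous_normed
      φ.hasCompactSupport_normed _ (fun z => rfl)
  · rw [dist_comm]
    refine lt_of_le_of_lt (φ.dist_normed_convolution_le (ε := ε / 2)
      f.continuous.aestronglyMeasurable ?_) (by linarith)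
    intro w hw
    exact (hu z hz w hw).le

/-- **Sternfeld–Weit theorem.** If `V` is a closed linear subspace of `C(ℂ, ℂ)`
(compact-open topology) invariant under all the affine substitution operators
`T_{a,b}(f)(z) = f (a*z + b)`, then `V` is the closed linear span of a set of monomials
`z ↦ z^α * conj z ^ β` determined by finitely many pairs `(n k, m k) ∈ (ℕ ∪ {∞})²`. -/
theorem sternfeld_weit
    (V : Submodule ℂ C(ℂ, ℂ)) (hVclosed : IsClosed (V : Set C(ℂ, ℂ)))
    (hVinv : ∀ a b : ℂ, ∀ f ∈ V, ∀ g : C(ℂ, ℂ),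
      (∀ z : ℂ, g z = f (a * z + b)) → g ∈ V) :
    ∃ (r : ℕ) (n m : Fin r → ℕ∞),
      (V : Set C(ℂ, ℂ)) =
        closure (Submodule.span ℂ
          { g : C(ℂ, ℂ) | ∃ (α β : ℕ) (k : Fin r),
              (α : ℕ∞) ≤ n k ∧ (β : ℕ∞) ≤ m k ∧
              ∀ z : ℂ, g z = z ^ α * (starRingEnd ℂ) z ^ β } : Set C(ℂ, ℂ)) := by
  obtain ⟨S, hS⟩ := SW_dickson (fun a b => SWmono a b ∈ V)
    (SW_lower1 V hVclosed hVinv) (SW_lower2 V hVclosed hVinv)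
  refine ⟨S.card, fun k => (S.equivFin.symm k).1.1, fun k => (S.equivFin.symm k).1.2, ?_⟩
  have hS' : ∀ a b : ℕ, SWmono a b ∈ V ↔ ∃ k : Fin S.card,
      (a : ℕ∞) ≤ (S.equivFin.symm k).1.1 ∧ (b : ℕ∞) ≤ (S.equivFin.symm k).1.2 := by
    intro a b
    rw [hS]
    constructor
    · rintro ⟨p, hp, h⟩
      exact ⟨S.equivFin ⟨p, hp⟩, by simpa using h⟩
    · rintro ⟨k, h⟩
      exact ⟨_, (S.equivFin.symm k).2, h⟩
  generalize hD : { g : C(ℂ, ℂ) | ∃ (α β : ℕ) (k : Fin S.card),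
              (α : ℕ∞) ≤ (S.equivFin.symm k).1.1 ∧ (β : ℕ∞) ≤ (S.equivFin.symm k).1.2 ∧
              ∀ z : ℂ, g z = z ^ α * (starRingEnd ℂ) z ^ β } = D
  have hDm : ∀ a b, SWmono a b ∈ V → SWmono a b ∈ Submodule.span ℂ D := by
    intro a b h
    obtain ⟨k, h1, h2⟩ := (hS' a b).1 h
    apply Submodule.subset_span
    rw [← hD]
    exact ⟨a, b, k, h1, h2, fun z => rfl⟩
  have hDV : (Submodule.span ℂ D : Set C(ℂ, ℂ)) ⊆ V := by
    rw [SetLike.coe_subset_coe, Submodule.span_le, ← hD]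
    rintro g ⟨a, b, k, h1, h2, hg⟩
    have : g = SWmono a b := by ext z; exact hg z
    rw [this]
    exact (hS' a b).2 ⟨k, h1, h2⟩
  refine Set.Subset.antisymm ?_ (closure_minimal hDV hVclosed)
  by_cases hall : ∀ a b, SWmono a b ∈ V
  · exact fun f _ => SW_dense _ (fun a b => hDm a b (hall a b)) f
  · push Not at hall
    obtain ⟨i, j, hij⟩ := hall
    intro f hf
    refine closure_minimal ?_ isClosed_closure (SW_smooth_dense V hVclosed hVinv f hf)
    rintro F ⟨hFV, hF⟩
    obtain ⟨c, hc⟩ := SW_exists_SWP hF i j (fun z => by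
      by_contra hne
      exact hij (SW_mono_mem V hVclosed hVinv F hF hFV z i j hne))
    refine hc.mem_closure _ fun p hp => hDm _ _ ?_
    exact SW_mono_mem V hVclosed hVinv F hF hFV 0 p.1 p.2 (SW_coeff hc p.1 p.2 hp)
end

section
/- Let d ≥ 1 and let V be a closed linear subspace of C(ℝ^d,ℝ) (with the topology of uniform convergence on compact sets) such that S_{a,b}(V) ⊆ V for all a,b ∈ ℝ^d, where S_{a,b}(f)(x) = f(a·x + b) and a·x denotes the coordinatewise product. Then there exists a finite set of points {n_k}_{k=1}^r ⊆ (ℕ ∪ {+∞})^d such that V is the closed linear span (in C(ℝ^d,ℝ)) of the set of monomial functions {x ↦ x^α : α ∈ ℕ^d and there exists k ∈ {1,…,r} with α_i ≤ n_{k,i} for all i = 1,…,d}. -/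
open Set Filter Topology MeasureTheory

theorem pk_mem_of_approx {X : Type*} [TopologicalSpace X] {V : Set C(X, ℝ)} (hV : IsClosed V)
    (g : C(X, ℝ)) (h : ∀ K : Set X, IsCompact K → ∀ ε > 0, ∃ v ∈ V, ∀ x ∈ K, |v x - g x| < ε) :
    g ∈ V := by
  rw [← hV.closure_eq, mem_closure_iff_nhds]
  intro t ht
  have := (nhds_basis_uniformity' ((Metric.uniformity_basis_dist (α := ℝ)).compactConvergenceUniformity
    (α := X))).mem_iff.1 ht
  obtain ⟨⟨K, ε⟩, ⟨hK, hε⟩, hs⟩ := this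
  obtain ⟨v, hv, hvx⟩ := h K hK ε hε
  refine ⟨v, hs ?_, hv⟩
  intro x hx
  have := hvx x hx
  simpa [Real.dist_eq, abs_sub_comm] using this

theorem pk_integral_mem {X : Type*} [TopologicalSpace X] {V : Submodule ℝ C(X, ℝ)}
    (hV : IsClosed (V : Set C(X, ℝ))) (M : ℝ → C(X, ℝ)) (hM : Continuous M) (hMV : ∀ u, M u ∈ V)
    (g : C(X, ℝ)) (hg : ∀ x, g x = ∫ u in (0:ℝ)..1, M u x) : g ∈ V := by
  refine pk_mem_of_approx hV g fun K hK ε hε => ?_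
  have : CompactSpace K := isCompact_iff_compactSpace.1 hK
  let μ : Measure ℝ := volume.restrict (Ioc 0 1)
  have : IsProbabilityMeasure μ := ⟨by simp [μ]⟩
  let R : C(X, ℝ) → C(K, ℝ) := fun f => f.restrict K
  have hRc : Continuous R := ContinuousMap.continuous_restrict K
  let F : ℝ → C(K, ℝ) := fun u => R (M u)
  have hF : Continuous F := hRc.comp hM
  let s : Set C(K, ℝ) := closure (R '' V)
  have hconv : Convex ℝ (R '' (V : Set C(X, ℝ))) := by
    rintro _ ⟨a, ha, rfl⟩ _ ⟨b, hb, rfl⟩ p q _ _ _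
    exact ⟨p • a + q • b, V.add_mem (V.smul_mem _ ha) (V.smul_mem _ hb), rfl⟩
  have hFi : Integrable F μ := (hF.integrableOn_Icc (a := 0) (b := 1)).mono_set Ioc_subset_Icc_self
  have hmem : ∫ u, F u ∂μ ∈ s :=
    hconv.closure.integral_mem isClosed_closure
      (Eventually.of_forall fun u => subset_closure ⟨_, hMV u, rfl⟩) hFi
  obtain ⟨_, ⟨v, hv, rfl⟩, hd⟩ := Metric.mem_closure_iff.1 hmem ε hε
  refine ⟨v, hv, fun x hx => ?_⟩
  have h1 := (ContinuousMap.dist_lt_iff hε).1 hd ⟨x, hx⟩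
  rw [ContinuousMap.integral_apply hFi] at h1
  rw [hg, intervalIntegral.integral_of_le zero_le_one]
  rw [Real.dist_eq, abs_sub_comm] at h1
  exact h1

/-- family closure -/
theorem pk_family_mem {X : Type*} [TopologicalSpace X] {V : Submodule ℝ C(X, ℝ)}
    (hV : IsClosed (V : Set C(X, ℝ))) (Q : C(ℝ × X, ℝ)) (h : ∀ s ≠ 0, Q.curry s ∈ V) :
    Q.curry 0 ∈ V := by
  have hc : Continuous Q.curry := Q.curry.continuous
  have : (0:ℝ) ∈ closure {s : ℝ | s ≠ 0} := by
    have := dense_compl_singleton (0:ℝ)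
    exact this 0
  have h2 := map_mem_closure hc this (t := (V : Set C(X, ℝ))) (fun s hs => h s hs)
  rwa [hV.closure_eq] at h2

theorem pk_calc (φ : ℝ → ℝ) (hφ : Continuous φ) (p q h : ℝ) :
    h * (∫ u in (0:ℝ)..1, φ (q + u * h)) - h * (∫ u in (0:ℝ)..1, φ (p + u * h)) =
    (q - p) * ∫ u in (0:ℝ)..1, (φ (p + u * (q - p) + h) - φ (p + u * (q - p))) := by
  have key : ∀ a c : ℝ, c * (∫ u in (0:ℝ)..1, φ (a + u * c)) = ∫ x in a..(a + c), φ x := by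
    intro a c
    simp only [mul_comm _ c]
    simp
  have hi : ∀ a b, IntervalIntegrable φ volume a b := fun a b => hφ.intervalIntegrable a b
  rw [intervalIntegral.integral_sub, mul_sub, key, key, key]
  · have e : ∀ u, p + u * (q - p) + h = (p + h) + u * (q - p) := fun u => by ring
    simp only [e]
    rw [key]
    have e1 : p + h + (q - p) = q + h := by ring
    have e2 : p + (q - p) = q := by ring
    rw [e1, e2]
    have a1 := intervalIntegral.integral_add_adjacent_intervals (hi p q) (hi q (q+h))
    have a2 := intervalIntegral.integral_add_adjacent_intervals (hi p (p+h)) (hi (p+h) (q+h))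
    linarith
  · apply Continuous.intervalIntegrable; fun_prop
  · apply Continuous.intervalIntegrable; fun_prop

theorem pk_dickson {d : ℕ} (A : Set (Fin d → ℕ)) (hA : ∀ α ∈ A, ∀ β ≤ α, β ∈ A) :
    ∃ (r : ℕ) (n : Fin r → Fin d → ℕ∞), ∀ α : Fin d → ℕ,
      α ∈ A ↔ ∃ k, ∀ i, (α i : ℕ∞) ≤ n k i := by
  let B : Set (Fin d → ℕ∞) := {n | ∀ α : Fin d → ℕ, (∀ i, (α i : ℕ∞) ≤ n i) → α ∈ A}
  let M : Set (Fin d → ℕ∞) := {m | Maximal (· ∈ B) m}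
  have hMfin : M.Finite := by
    have hanti : IsAntichain (· ≤ ·) M := setOfPred_maximal_antichain _
    exact WellQuasiOrderedLE.finite_of_isAntichain hanti
  obtain ⟨r, e⟩ := hMfin.fin_embedding |> fun ⟨r, f, hf⟩ => (⟨r, f, hf⟩ : ∃ r, ∃ f : Fin r ↪ (Fin d → ℕ∞), range f = M)
  obtain ⟨f, hf⟩ := e
  refine ⟨r, f, fun α => ⟨fun hα => ?_, ?_⟩⟩
  · have hαB : (fun i => (α i : ℕ∞)) ∈ B := by
      intro β hβ
      exact hA α hα β (fun i => by simpa using hβ i)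
    have hz : ∀ c ⊆ B, IsChain (· ≤ ·) c → ∀ y ∈ c, ∃ ub ∈ B, ∀ z ∈ c, z ≤ ub := ?_
    · obtain ⟨m, hm, hmax⟩ := zorn_le_nonempty₀ B hz _ hαB
      have : m ∈ range f := hf ▸ hmax
      obtain ⟨k, rfl⟩ := this
      exact ⟨k, hm⟩
    · intro c hcB hc y hy
      refine ⟨sSup c, ?_, fun z hz => le_sSup hz⟩
      intro β hβ
      have h1 : ∀ i, ∃ z ∈ c, (β i : ℕ∞) ≤ z i := by
        intro i
        rcases Nat.eq_zero_or_pos (β i) with h0 | h0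
        · exact ⟨y, hy, by simp [h0]⟩
        · have h2 : ((β i - 1 : ℕ) : ℕ∞) < sSup c i :=
            lt_of_lt_of_le (by exact_mod_cast Nat.sub_lt h0 one_pos) (hβ i)
          rw [sSup_apply, lt_iSup_iff] at h2
          obtain ⟨⟨z, hz⟩, hlt⟩ := h2
          refine ⟨z, hz, ?_⟩
          have := Order.add_one_le_of_lt hlt
          have e : ((β i - 1 : ℕ) : ℕ∞) + 1 = (β i : ℕ∞) := by
            exact_mod_cast Nat.sub_add_cancel h0
          rwa [e] at this
      choose z hz hβz using h1
      have h3 : ∃ w ∈ c, ∀ i, z i ≤ w := by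
        have : ∀ s : Finset (Fin d), ∃ w ∈ c, ∀ i ∈ s, z i ≤ w := by
          intro s
          induction s using Finset.induction_on with
          | empty => exact ⟨y, hy, by simp⟩
          | insert a s _ ih =>
            obtain ⟨w, hw, hws⟩ := ih
            obtain ⟨w', hw', h1, h2⟩ := hc.directedOn w hw (z a) (hz a)
            refine ⟨w', hw', fun i hi => ?_⟩
            rcases Finset.mem_insert.1 hi with rfl | hi
            · exact h2
            · exact (hws i hi).trans h1
        obtain ⟨w, hw, h⟩ := this Finset.univ
        exact ⟨w, hw, fun i => h i (Finset.mem_univ i)⟩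
      obtain ⟨w, hw, hzw⟩ := h3
      exact hcB hw β fun i => (hβz i).trans (hzw i i)
  · rintro ⟨k, hk⟩
    have : f k ∈ M := hf ▸ mem_range_self k
    exact this.1 α hk

/-- Affine substitution in the `i`-th coordinate. -/
def pkT {d : ℕ} (i : Fin d) (a b : ℝ) (f : C((Fin d → ℝ), ℝ)) : C((Fin d → ℝ), ℝ) :=
  ⟨fun x => f (Function.update x i (a * x i + b)), by fun_prop⟩

/-- The `j`-th power of the `i`-th coordinate function. -/
def pkM {d : ℕ} (i : Fin d) (j : ℕ) : C((Fin d → ℝ), ℝ) := ⟨fun x => x i ^ j, by fun_prop⟩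

/-- forward difference operator in the `i`-th coordinate -/
def pkD {d : ℕ} (i : Fin d) (h : ℝ) (f : C((Fin d → ℝ), ℝ)) : C((Fin d → ℝ), ℝ) :=
  pkT i 1 h f - f

theorem pkT_apply {d : ℕ} (i : Fin d) (a b : ℝ) (f : C((Fin d → ℝ), ℝ)) (x) :
    pkT i a b f x = f (Function.update x i (a * x i + b)) := rfl

theorem pkM_apply {d : ℕ} (i : Fin d) (j : ℕ) (x) : pkM i j x = x i ^ j := rfl

theorem pkD_apply {d : ℕ} (i : Fin d) (h : ℝ) (f : C((Fin d → ℝ), ℝ)) (x) :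
    pkD i h f x = f (Function.update x i (x i + h)) - f x := by
  simp [pkD, pkT_apply]

/-- Invariance hypothesis. -/
def pkInv {d : ℕ} (V : Submodule ℝ C((Fin d → ℝ), ℝ)) : Prop :=
  ∀ a b : Fin d → ℝ, ∀ f ∈ V, ∀ g : C((Fin d → ℝ), ℝ),
      (∀ x : Fin d → ℝ, g x = f (a * x + b)) → g ∈ V

theorem pkT_mem {d : ℕ} {V : Submodule ℝ C((Fin d → ℝ), ℝ)} (hV : pkInv V) (i : Fin d) (a b : ℝ)
    {f : C((Fin d → ℝ), ℝ)} (hf : f ∈ V) : pkT i a b f ∈ V := by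
  refine hV (Function.update 1 i a) (Pi.single i b) f hf _ fun x => ?_
  rw [pkT_apply]
  congr 1
  ext k
  by_cases hk : k = i
  · subst hk; simp
  · simp [hk]

/-- key step: raise the weight by one -/
theorem pk_step {d : ℕ} {V : Submodule ℝ C((Fin d → ℝ), ℝ)}
    (hVc : IsClosed (V : Set C((Fin d → ℝ), ℝ))) (i : Fin d) (j : ℕ)
    (k : C((Fin d → ℝ), ℝ)) (hk : ∀ a b, pkM i j * pkT i a b k ∈ V) (h : ℝ) (a b : ℝ) :
    pkM i (j + 1) * pkT i a b (pkD i h k) ∈ V := by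
  -- averaged functions
  let I : ℝ → C((Fin d → ℝ), ℝ) := fun a' =>
    ⟨fun x => ∫ u in (0:ℝ)..1, x i ^ j * k (Function.update x i (a' * x i + b + u * h)), by
      apply intervalIntegral.continuous_parametric_intervalIntegral_of_continuous'
      fun_prop⟩
  have hI : ∀ a', I a' ∈ V := by
    intro a'
    let F : C(ℝ × (Fin d → ℝ), ℝ) :=
      ⟨fun p => p.2 i ^ j * k (Function.update p.2 i (a' * p.2 i + b + p.1 * h)), by fun_prop⟩
    refine pk_integral_mem hVc F.curry F.curry.continuous (fun u => ?_) (I a') (fun x => rfl)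
    have := hk a' (b + u * h)
    convert this using 1
    ext x
    simp [F, pkM_apply, pkT_apply, add_assoc]
  let Q : C(ℝ × (Fin d → ℝ), ℝ) :=
    ⟨fun p => ∫ u in (0:ℝ)..1, p.2 i ^ (j + 1) *
      pkD i h k (Function.update p.2 i (a * p.2 i + b + u * (p.1 * p.2 i))), by
      apply intervalIntegral.continuous_parametric_intervalIntegral_of_continuous'
      fun_prop⟩
  have hQ := pk_family_mem hVc Q ?_
  · convert hQ using 1
    ext x
    simp [Q, pkM_apply, pkT_apply]
  · intro s hs
    have hm : s⁻¹ • (h • I (a + s) - h • I a) ∈ V :=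
      V.smul_mem _ (V.sub_mem (V.smul_mem _ (hI _)) (V.smul_mem _ (hI _)))
    convert hm using 1
    ext x
    have := pk_calc (fun t => k (Function.update x i t)) (by fun_prop)
      (a * x i + b) ((a + s) * x i + b) h
    have e : (a + s) * x i + b - (a * x i + b) = s * x i := by ring
    rw [e] at this
    simp only [Q, I, ContinuousMap.curry_apply, ContinuousMap.coe_mk, ContinuousMap.smul_apply,
      ContinuousMap.sub_apply, smul_eq_mul, intervalIntegral.integral_const_mul, pkD_apply,
      Function.update_self, Function.update_idem]
    rw [eq_inv_mul_iff_mul_eq₀ hs]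
    linear_combination (- x i ^ j) * this

theorem pk_iter {d : ℕ} {V : Submodule ℝ C((Fin d → ℝ), ℝ)}
    (hVc : IsClosed (V : Set C((Fin d → ℝ), ℝ))) (hV : pkInv V) (i : Fin d) (h : ℝ)
    (f : C((Fin d → ℝ), ℝ)) (hf : f ∈ V) (j : ℕ) :
    ∀ a b, pkM i j * pkT i a b ((pkD i h)^[j] f) ∈ V := by
  induction j with
  | zero =>
    intro a b
    convert pkT_mem hV i a b hf using 1
    ext x
    simp [pkM_apply]
  | succ j ih =>
    rw [Function.iterate_succ_apply']
    exact pk_step hVc i j _ ih h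

theorem pk_lower {d : ℕ} {V : Submodule ℝ C((Fin d → ℝ), ℝ)}
    (hVc : IsClosed (V : Set C((Fin d → ℝ), ℝ))) (hV : pkInv V) (i : Fin d)
    (c : C((Fin d → ℝ), ℝ)) (hc : ∀ x s, c (Function.update x i s) = c x) (m m' : ℕ)
    (hm : m' ≤ m) (hmem : pkM i m * c ∈ V) : pkM i m' * c ∈ V := by
  induction m, hm using Nat.le_induction with
  | base => exact hmem
  | succ m hm ih =>
    apply ih
    let Q : C(ℝ × (Fin d → ℝ), ℝ) :=
      ⟨fun p => (∑ l ∈ Finset.range (m + 1), (p.2 i + p.1) ^ l * p.2 i ^ (m + 1 - 1 - l)) * c p.2,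
        by fun_prop⟩
    have hQ := pk_family_mem hVc Q ?_
    · have := V.smul_mem ((m + 1 : ℝ)⁻¹) hQ
      convert this using 1
      ext x
      have e : ∑ l ∈ Finset.range (m + 1), (x i + 0) ^ l * x i ^ (m + 1 - 1 - l)
          = (m + 1) * x i ^ m := by
        rw [Finset.sum_congr rfl (g := fun _ => x i ^ m)]
        · simp
        · intro l hl
          rw [add_zero, ← pow_add]
          congr 1
          have := Finset.mem_range.1 hl
          omega
      simp only [Q, ContinuousMap.curry_apply, ContinuousMap.coe_mk, ContinuousMap.smul_apply,
        ContinuousMap.mul_apply, smul_eq_mul, e, pkM_apply]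
      have : (m + 1 : ℝ) ≠ 0 := by positivity
      field_simp
    · intro s hs
      have h1 : s⁻¹ • (pkT i 1 s (pkM i (m + 1) * c) - pkM i (m + 1) * c) ∈ V :=
        V.smul_mem _ (V.sub_mem (pkT_mem hV _ _ _ hmem) hmem)
      convert h1 using 1
      ext x
      have e := (Commute.all (x i + s) (x i)).geom_sum₂_mul (m + 1)
      simp only [Q, ContinuousMap.curry_apply, ContinuousMap.coe_mk, ContinuousMap.smul_apply,
        ContinuousMap.mul_apply, ContinuousMap.sub_apply, smul_eq_mul, pkM_apply, pkT_apply, hc,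
        Function.update_self, one_mul]
      rw [eq_inv_mul_iff_mul_eq₀ hs]
      have e2 : x i + s - x i = s := by ring
      rw [e2] at e
      linear_combination c x * e

open Function in
theorem pkD_iter_apply {d : ℕ} (i : Fin d) (h : ℝ) (f : C((Fin d → ℝ), ℝ)) (j : ℕ) (x : Fin d → ℝ)
    (t : ℝ) : (pkD i h)^[j] f (Function.update x i t) =
      (fwdDiff h)^[j] (fun t => f (Function.update x i t)) t := by
  induction j generalizing t with
  | zero => rfl
  | succ j ih =>
    rw [iterate_succ_apply', iterate_succ_apply', pkD_apply, fwdDiff]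
    simp only [update_self, update_idem, ih]

theorem pk_bern_identity (φ : ℝ → ℝ) (h τ b : ℝ) (N : ℕ) :
    ∑ k ∈ Finset.range (N + 1), (N.choose k : ℝ) * τ ^ k * (1 - τ) ^ (N - k) * φ (b + k * h) =
    ∑ j ∈ Finset.range (N + 1), (N.choose j : ℝ) * τ ^ j * (fwdDiff h)^[j] φ b := by
  let S : Module.End ℝ (ℝ → ℝ) :=
    { toFun := fun φ t => φ (t + h), map_add' := fun _ _ => rfl, map_smul' := fun _ _ => rfl }
  have hS : ∀ k : ℕ, ∀ t, (S ^ k) φ t = φ (t + k * h) := by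
    intro k
    induction k with
    | zero => intro t; simp
    | succ k ih =>
      intro t
      rw [pow_succ', Module.End.mul_apply]
      change (S ^ k) φ (t + h) = _
      rw [ih]; push_cast; congr 1; ring
  have hD : ∀ j : ℕ, ((S - 1) ^ j) φ = (fwdDiff h)^[j] φ := by
    intro j
    induction j with
    | zero => simp
    | succ j ih =>
      rw [pow_succ', Module.End.mul_apply, ih, Function.iterate_succ_apply']
      rfl
  have key : (τ • S + (1 - τ) • 1) ^ N = (τ • (S - 1) + 1) ^ N := by
    congr 1
    module
  rw [Commute.add_pow ((Commute.one_right _).smul_right _),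
    Commute.add_pow (Commute.one_right _)] at key
  have := congrFun (congrArg (fun T : Module.End ℝ (ℝ → ℝ) => T φ) key) b
  simp only [smul_pow, one_pow, mul_one, LinearMap.sum_apply, Finset.sum_apply,
    Module.End.mul_apply, LinearMap.smul_apply, Module.End.one_apply, map_smul,
    Module.End.natCast_apply, Pi.smul_apply, smul_eq_mul, hS, hD, map_nsmul] at this
  calc _ = _ := Finset.sum_congr rfl fun k _ => ?_
    _ = _ := this
    _ = _ := Finset.sum_congr rfl fun k _ => ?_
  · simp only [nsmul_eq_mul]; ring
  · simp only [nsmul_eq_mul]; ring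

theorem pk_bern_approx {d : ℕ} (i : Fin d) (g : C((Fin d → ℝ), ℝ)) (K : Set (Fin d → ℝ))
    (hK : IsCompact K) (R : ℝ) (hR : 0 < R) (hKR : ∀ x ∈ K, |x i| ≤ R) (ε : ℝ) (hε : 0 < ε) :
    ∃ (N : ℕ) (h : ℝ), ∀ x ∈ K,
      |∑ j ∈ Finset.range (N + 1), (N.choose j : ℝ) * ((x i + R) * (2 * R)⁻¹) ^ j *
        pkT i 0 (-R) ((pkD i h)^[j] g) x - g x| < ε := by
  let Φ : C(unitInterval × (Fin d → ℝ), ℝ) :=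
    ⟨fun p => g (Function.update p.2 i (-R + (p.1 : ℝ) * (2 * R))), by fun_prop⟩
  have hB := bernsteinApproximation_uniform Φ.curry
  have hU := (ContinuousMap.continuous_uncurry (X := unitInterval) (Y := Fin d → ℝ) (Z := ℝ)).tendsto Φ.curry |>.comp hB
  rw [ContinuousMap.tendsto_iff_forall_isCompact_tendstoUniformlyOn] at hU
  have hU2 := Metric.tendstoUniformlyOn_iff.1
    (hU (Set.univ ×ˢ K) (isCompact_univ.prod hK)) ε hε
  obtain ⟨N, hN, hN0⟩ := (hU2.and (eventually_ne_atTop 0)).exists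
  refine ⟨N, 2 * R / N, fun x hx => ?_⟩
  have hxR := abs_le.1 (hKR x hx)
  let τ : unitInterval := ⟨(x i + R) * (2 * R)⁻¹, by
    constructor
    · apply mul_nonneg <;> [linarith; positivity]
    · rw [← div_eq_mul_inv, div_le_one (by positivity)]; linarith⟩
  have h1 := hN (τ, x) ⟨Set.mem_univ _, hx⟩
  have e1 : ContinuousMap.uncurry Φ.curry (τ, x) = g x := by
    change g (Function.update x i (-R + (x i + R) * (2 * R)⁻¹ * (2 * R))) = g x
    have : -R + (x i + R) * (2 * R)⁻¹ * (2 * R) = x i := by field_simp; ring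
    rw [this, Function.update_eq_self]
  have e2 : ContinuousMap.uncurry (bernsteinApproximation N Φ.curry) (τ, x) =
      ∑ j ∈ Finset.range (N + 1), (N.choose j : ℝ) * ((x i + R) * (2 * R)⁻¹) ^ j *
        pkT i 0 (-R) ((pkD i (2 * R / N))^[j] g) x := by
    change (bernsteinApproximation N Φ.curry τ) x = _
    rw [bernsteinApproximation.apply]
    simp only [pkT_apply, pkD_iter_apply, zero_mul, zero_add]
    rw [← pk_bern_identity, Finset.sum_range]
    rw [ContinuousMap.sum_apply]
    refine Finset.sum_congr rfl fun k _ => ?_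
    rw [ContinuousMap.smul_apply, bernstein_apply, smul_eq_mul]
    congr 1
    change g (Function.update x i (-R + ((k : ℝ) / N) * (2 * R))) = _
    congr 2
    ring
  rw [Function.comp_apply, e1, e2, Real.dist_eq, abs_sub_comm] at h1
  exact h1

/-- homogeneity in coordinate `i` -/
def pkHom {d : ℕ} (i : Fin d) (m : ℕ) (g : C((Fin d → ℝ), ℝ)) : Prop :=
  ∀ x s, g (Function.update x i s) = s ^ m * g (Function.update x i 1)

theorem pkHom_D {d : ℕ} {i i' : Fin d} (hi : i' ≠ i) (m : ℕ) (h : ℝ) (g : C((Fin d → ℝ), ℝ))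
    (hg : pkHom i' m g) : pkHom i' m (pkD i h g) := by
  intro x s
  simp only [pkD_apply, Function.update_of_ne hi.symm]
  rw [Function.update_comm hi, Function.update_comm hi, hg, hg x s]
  ring

theorem pkHom_D_iter {d : ℕ} {i i' : Fin d} (hi : i' ≠ i) (m : ℕ) (h : ℝ) (g : C((Fin d → ℝ), ℝ))
    (hg : pkHom i' m g) (j : ℕ) : pkHom i' m ((pkD i h)^[j] g) := by
  induction j with
  | zero => exact hg
  | succ j ih =>
    rw [Function.iterate_succ_apply']
    exact pkHom_D hi m h _ ih

theorem pk_hom_all {d : ℕ} (α : Fin d → ℕ) (g : C((Fin d → ℝ), ℝ)) (hg : ∀ i, pkHom i (α i) g)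
    (x : Fin d → ℝ) : g x = (∏ i, x i ^ α i) * g 1 := by
  have key : ∀ T : Finset (Fin d), g x = (∏ i ∈ T, x i ^ α i) * g (T.piecewise 1 x) := by
    intro T
    induction T using Finset.induction_on with
    | empty => simp
    | insert a T ha ih =>
      rw [ih, Finset.prod_insert ha, Finset.piecewise_insert]
      have h1 := hg a (T.piecewise 1 x) (x a)
      have : Function.update (T.piecewise 1 x) a (x a) = T.piecewise 1 x := by
        rw [Function.update_eq_self_iff]; simp [ha]
      rw [this] at h1
      rw [h1, Pi.one_apply]; ring
  have := key Finset.univ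
  simpa using this

/-- set of monomials in V -/
def pkW {d : ℕ} (V : Submodule ℝ C((Fin d → ℝ), ℝ)) : Submodule ℝ C((Fin d → ℝ), ℝ) :=
  (Submodule.span ℝ {g : C((Fin d → ℝ), ℝ) | g ∈ V ∧ ∃ α : Fin d → ℕ,
    ∀ x : Fin d → ℝ, g x = ∏ i : Fin d, x i ^ α i}).topologicalClosure

theorem pk_main {d : ℕ} {V : Submodule ℝ C((Fin d → ℝ), ℝ)}
    (hVc : IsClosed (V : Set C((Fin d → ℝ), ℝ))) (hV : pkInv V) (n : ℕ) :
    ∀ S : Finset (Fin d), Sᶜ.card = n → ∀ α : Fin d → ℕ, ∀ g ∈ V,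
      (∀ i ∈ S, pkHom i (α i) g) → g ∈ pkW V := by
  induction n with
  | zero =>
    intro S hS α g hg hh
    have hS' : ∀ i, i ∈ S := by
      intro i
      by_contra hi
      have : i ∈ Sᶜ := Finset.mem_compl.2 hi
      rw [Finset.card_eq_zero.1 hS] at this
      simp at this
    have hx := pk_hom_all α g (fun i => hh i (hS' i))
    by_cases h0 : g 1 = 0
    · have : g = 0 := by
        ext x; rw [hx, h0]; simp
      rw [this]; exact Submodule.zero_mem _
    · have h1 : (g 1)⁻¹ • g ∈ pkW V := by
        apply Submodule.le_topologicalClosure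
        apply Submodule.subset_span
        refine ⟨V.smul_mem _ hg, α, fun x => ?_⟩
        rw [ContinuousMap.smul_apply, hx x, smul_eq_mul]
        field_simp
      have := (pkW V).smul_mem (g 1) h1
      rwa [smul_smul, mul_inv_cancel₀ h0, one_smul] at this
  | succ n ih =>
    intro S hS α g hg hh
    obtain ⟨i, hi⟩ : Sᶜ.Nonempty := by
      rw [← Finset.card_pos]; omega
    have hiS : i ∉ S := Finset.mem_compl.1 hi
    have hterm : ∀ (h b : ℝ) (j m : ℕ), m ≤ j →
        pkM i m * pkT i 0 b ((pkD i h)^[j] g) ∈ pkW V := by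
      intro h b j m hm
      have h1 : pkM i m * pkT i 0 b ((pkD i h)^[j] g) ∈ V := by
        refine pk_lower hVc hV i _ (fun x s => ?_) j m hm (pk_iter hVc hV i h g hg j 0 b)
        simp [pkT_apply]
      refine ih (insert i S) ?_ (Function.update α i m) _ h1 ?_
      · rw [Finset.card_compl] at hS ⊢
        rw [Finset.card_insert_of_notMem hiS]
        omega
      · intro i' hi'
        rcases Finset.mem_insert.1 hi' with rfl | hi'
        · intro x s
          simp [pkM_apply, pkT_apply]
        · have hne : i' ≠ i := fun e => hiS (e ▸ hi')
          intro x s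
          have h2 := pkHom_D_iter hne (α i') h g (hh i' hi') j (Function.update x i b) s
          simp only [ContinuousMap.mul_apply, pkM_apply, pkT_apply, zero_mul, zero_add,
            Function.update_of_ne hne.symm, Function.update_of_ne hne]
          rw [Function.update_comm hne, Function.update_comm hne, h2]
          ring
    refine pk_mem_of_approx (Submodule.isClosed_topologicalClosure _) g fun K hK ε hε => ?_
    obtain ⟨R, hR, hKR⟩ : ∃ R > 0, ∀ x ∈ K, |x i| ≤ R := by
      obtain ⟨R, hR⟩ := (hK.image (f := fun x : Fin d → ℝ => |x i|) (by fun_prop)).bddAbove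
      exact ⟨max R 1, by positivity, fun x hx => (hR ⟨x, hx, rfl⟩).trans (le_max_left _ _)⟩
    obtain ⟨N, h, hN⟩ := pk_bern_approx i g K hK R hR hKR ε hε
    refine ⟨∑ j ∈ Finset.range (N + 1), (N.choose j : ℝ) • ((2 * R)⁻¹ ^ j •
      ∑ m ∈ Finset.range (j + 1), (R ^ (j - m) * (j.choose m : ℝ)) •
        (pkM i m * pkT i 0 (-R) ((pkD i h)^[j] g))), ?_, fun x hx => ?_⟩
    · refine Submodule.sum_mem _ fun j _ => Submodule.smul_mem _ _ (Submodule.smul_mem _ _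
        (Submodule.sum_mem _ fun m hm => Submodule.smul_mem _ _ (hterm _ _ _ _ ?_)))
      have := Finset.mem_range.1 hm
      omega
    · convert hN x hx using 3
      rw [ContinuousMap.sum_apply]
      refine Finset.sum_congr rfl fun j _ => ?_
      simp only [ContinuousMap.smul_apply, ContinuousMap.sum_apply, ContinuousMap.mul_apply,
        smul_eq_mul, pkM_apply]
      rw [mul_pow, add_pow, Finset.sum_mul, Finset.mul_sum, Finset.mul_sum, Finset.mul_sum,
        Finset.sum_mul]
      exact Finset.sum_congr rfl fun m _ => by ring

theorem pk_mono_lower {d : ℕ} {V : Submodule ℝ C((Fin d → ℝ), ℝ)}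
    (hVc : IsClosed (V : Set C((Fin d → ℝ), ℝ))) (hV : pkInv V) (α β : Fin d → ℕ) (hβ : β ≤ α)
    (hα : (∏ i, pkM i (α i)) ∈ V) : (∏ i, pkM i (β i)) ∈ V := by
  have key : ∀ T : Finset (Fin d), (∏ i, pkM i (T.piecewise β α i)) ∈ V := by
    intro T
    induction T using Finset.induction_on with
    | empty => simpa using hα
    | insert a T ha ih =>
      rw [← Finset.mul_prod_erase _ _ (Finset.mem_univ a)] at ih ⊢
      have e : ∏ i ∈ Finset.univ.erase a, pkM i ((insert a T).piecewise β α i) =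
          ∏ i ∈ Finset.univ.erase a, pkM i (T.piecewise β α i) := by
        refine Finset.prod_congr rfl fun i hi => ?_
        have : i ≠ a := Finset.ne_of_mem_erase hi
        simp [Finset.piecewise, this]
      rw [e]
      refine pk_lower hVc hV a _ (fun x s => ?_) _ _ ?_ ih
      · simp only [ContinuousMap.prod_apply]
        refine Finset.prod_congr rfl fun i hi => ?_
        rw [pkM_apply, pkM_apply, Function.update_of_ne (Finset.ne_of_mem_erase hi)]
      · simpa [ha] using hβ a
  simpa using key Finset.univ

/-- **Pinkus' theorem.** If `V` is a closed linear subspace of `C(ℝ^d, ℝ)`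
(compact-open topology) invariant under all the operators
`S_{a,b}(f)(x) = f (a·x + b)` (coordinatewise product and sum), then `V` is the closed
linear span of a set of monomials `x ↦ x^α` determined by finitely many points
`n k ∈ (ℕ ∪ {∞})^d`. -/
theorem pinkus_TDI (d : ℕ) (hd : 1 ≤ d)
    (V : Submodule ℝ C((Fin d → ℝ), ℝ)) (hVclosed : IsClosed (V : Set C((Fin d → ℝ), ℝ)))
    (hVinv : ∀ a b : Fin d → ℝ, ∀ f ∈ V, ∀ g : C((Fin d → ℝ), ℝ),
      (∀ x : Fin d → ℝ, g x = f (a * x + b)) → g ∈ V) :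
    ∃ (r : ℕ) (n : Fin r → Fin d → ℕ∞),
      (V : Set C((Fin d → ℝ), ℝ)) =
        closure (Submodule.span ℝ
          { g : C((Fin d → ℝ), ℝ) | ∃ (α : Fin d → ℕ) (k : Fin r),
              (∀ i : Fin d, (α i : ℕ∞) ≤ n k i) ∧
              ∀ x : Fin d → ℝ, g x = ∏ i : Fin d, x i ^ α i } : Set C((Fin d → ℝ), ℝ)) := by
  obtain ⟨r, n, hn⟩ := pk_dickson {α : Fin d → ℕ | (∏ i, pkM i (α i)) ∈ V}
    (fun α hα β hβ => pk_mono_lower hVclosed hVinv α β hβ hα)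
  have hmono : ∀ (g : C((Fin d → ℝ), ℝ)) (α : Fin d → ℕ),
      (∀ x : Fin d → ℝ, g x = ∏ i : Fin d, x i ^ α i) → g = ∏ i, pkM i (α i) := by
    intro g α h
    ext x
    simp [h, ContinuousMap.prod_apply, pkM_apply]
  refine ⟨r, n, Set.Subset.antisymm ?_ ?_⟩
  · intro f hf
    have h1 : f ∈ pkW V := pk_main hVclosed hVinv _ ∅ rfl 0 f hf (by simp)
    refine closure_mono ?_ h1
    refine Submodule.span_mono ?_
    rintro g ⟨hgV, α, hα⟩
    have h2 : α ∈ {α : Fin d → ℕ | (∏ i, pkM i (α i)) ∈ V} := by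
      rw [Set.mem_ofPred_eq, ← hmono g α hα]; exact hgV
    obtain ⟨k, hk⟩ := (hn α).1 h2
    exact ⟨α, k, hk, hα⟩
  · refine closure_minimal ?_ hVclosed
    refine Submodule.span_le.2 ?_
    rintro g ⟨α, k, hk, hα⟩
    have h2 := (hn α).2 ⟨k, hk⟩
    rw [hmono g α hα]
    exact h2
end
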